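/- Let I ⊂ S be a nonzero monomial ideal and v ∈ S a monomial. Then slength(I : v) ≤ slength(I), where (I : v) = {f ∈ S : v·f ∈ I} is the colon ideal. Moreover, if I = v·(I : v) then slength(I : v) = slength(I). -/

import Mathlib

open MvPolynomial

/-- The set of exponent vectors of the monomials in the Stanley space `x^u · K[Z]`. -/
def stanleySet {σ : Type} (u : σ →₀ ℕ) (Z : Set σ) : Set (σ →₀ ℕ) :=
  {w | ∃ v : σ →₀ ℕ, ↑v.support ⊆ Z ∧ w = u + v}

/-- A Stanley decomposition (partition into Stanley spaces) of a set `P` of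
exponent vectors of monomials.  By the standard correspondence, Stanley
decompositions of a multigraded `K`-vector subquotient of `S` spanned by the
monomials with exponents in `P` correspond exactly to such partitions. -/
structure StanleyPartition {σ : Type} (P : Set (σ →₀ ℕ)) where
  r : ℕ
  base : Fin r → σ →₀ ℕ
  vars : Fin r → Set σ
  cover : P = ⋃ i, stanleySet (base i) (vars i)
  disj : ∀ i j, i ≠ j → Disjoint (stanleySet (base i) (vars i)) (stanleySet (base j) (vars j))

/-- The Stanley length of `P`: the minimal length of a Stanley decomposition. -/
noncomputable def slength {σ : Type} (P : Set (σ →₀ ℕ)) : ℕ :=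
  sInf {r | ∃ D : StanleyPartition P, D.r = r}

/-- The set of exponent vectors of the monomials belonging to an ideal. -/
def monSet {σ K : Type} [Field K] (I : Ideal (MvPolynomial σ K)) : Set (σ →₀ ℕ) :=
  {d | (monomial d (1 : K) : MvPolynomial σ K) ∈ I}

/-- `I` is a monomial ideal. -/
def IsMonomialIdeal {σ K : Type} [Field K] (I : Ideal (MvPolynomial σ K)) : Prop :=
  ∃ A : Set (σ →₀ ℕ), I = Ideal.span ((fun d => (monomial d (1 : K) : MvPolynomial σ K)) '' A)

/-- Exponent vectors of the minimal monomial generators of `I`. -/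
def minGens {σ K : Type} [Field K] (I : Ideal (MvPolynomial σ K)) : Set (σ →₀ ℕ) :=
  {d | d ∈ monSet I ∧ ∀ e ∈ monSet I, e ≤ d → e = d}

theorem mem_stanleySet_iff {σ : Type} {u w : σ →₀ ℕ} {Z : Set σ} :
    w ∈ stanleySet u Z ↔ u ≤ w ∧ ∀ i ∉ Z, w i = u i := by
  constructor
  · rintro ⟨t, ht, rfl⟩
    refine ⟨le_self_add, fun i hi => ?_⟩
    have : t i = 0 := by
      by_contra h
      exact hi (ht (Finsupp.mem_support_iff.mpr h))
    simp [this]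
  · rintro ⟨h, hZ⟩
    refine ⟨w - u, fun i hi => ?_, (add_tsub_cancel_of_le h).symm⟩
    by_contra hiZ
    simp [hZ i hiZ] at hi

/-- A Stanley partition indexed by an arbitrary finite type can be indexed by `Fin`. -/
theorem StanleyPartition.exists_of_finite {σ ι : Type} [Finite ι] {P : Set (σ →₀ ℕ)}
    (base : ι → σ →₀ ℕ) (vars : ι → Set σ) (cover : P = ⋃ i, stanleySet (base i) (vars i))
    (disj : ∀ i j, i ≠ j →
      Disjoint (stanleySet (base i) (vars i)) (stanleySet (base j) (vars j))) :
    ∃ D : StanleyPartition P, D.r = Nat.card ι := by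
  let e := (Finite.equivFin ι).symm
  refine ⟨⟨Nat.card ι, base ∘ e, vars ∘ e, ?_, fun i j hij => disj _ _ (e.injective.ne hij)⟩, rfl⟩
  rw [cover]
  exact (e.surjective.iUnion_comp fun i => stanleySet (base i) (vars i)).symm

theorem slength_le_of_stanleyPartition {σ : Type} {P : Set (σ →₀ ℕ)} (D : StanleyPartition P) :
    slength P ≤ D.r :=
  Nat.sInf_le ⟨D, rfl⟩

theorem exists_stanleyPartition_r_eq_slength {σ : Type} {P : Set (σ →₀ ℕ)}
    (h : Nonempty (StanleyPartition P)) : ∃ D : StanleyPartition P, D.r = slength P :=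
  Nat.sInf_mem (s := {r | ∃ D : StanleyPartition P, D.r = r}) (h.elim fun D => ⟨D.r, D, rfl⟩)

/-- Every upper set of exponent vectors in finitely many variables has a Stanley partition. -/
theorem IsUpperSet.nonempty_stanleyPartition {σ : Type} [Finite σ] {P : Set (σ →₀ ℕ)}
    (hP : IsUpperSet P) : Nonempty (StanleyPartition P) := by
  classical
  have hfin : {m | Minimal (· ∈ P) m}.Finite :=
    (setOfPred_minimal_antichain (· ∈ P)).finite_of_partiallyWellOrderedOn
      (Set.isPWO_of_wellQuasiOrderedLE _)
  obtain ⟨b, hb⟩ := hfin.bddAbove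
  have hinf : ∀ w ∈ P, w ⊓ b ∈ P := by
    intro w hw
    obtain ⟨m, hmw, hm⟩ := exists_minimal_le_of_wellFoundedLT (· ∈ P) w hw
    exact hP (le_inf hmw (hb hm)) hm.prop
  have key : ∀ c ≤ b, ∀ w, w ∈ stanleySet c {i | c i = b i} ↔ w ⊓ b = c := by
    intro c hc w
    rw [mem_stanleySet_iff]
    constructor
    · rintro ⟨hcw, h⟩
      ext i
      have h1 := hc i
      have h2 := hcw i
      have h3 := h i
      simp only [Set.mem_ofPred_eq, Finsupp.inf_apply] at h3 ⊢
      grind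
    · rintro rfl
      refine ⟨inf_le_left, fun i hi => ?_⟩
      simp only [Set.mem_ofPred_eq, Finsupp.inf_apply] at hi ⊢
      grind
  have hIic : (Set.Iic b).Finite := by
    refine Set.Finite.of_injOn (f := fun w : σ →₀ ℕ => (w : σ → ℕ)) (t := Set.Iic (b : σ → ℕ))
      (fun w hw => hw) DFunLike.coe_injective.injOn ?_
    have := Fintype.ofFinite σ
    exact Set.finite_Iic _
  have : Finite ↥(P ∩ Set.Iic b) := hIic.inter_of_right P
  obtain ⟨D, -⟩ := StanleyPartition.exists_of_finite (P := P)
    (fun c : ↥(P ∩ Set.Iic b) => (c : σ →₀ ℕ)) (fun c => {i | (c : σ →₀ ℕ) i = b i})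
    (by
      ext w
      simp only [Set.mem_iUnion]
      constructor
      · intro hw
        exact ⟨⟨w ⊓ b, hinf w hw, Set.mem_Iic.mpr inf_le_right⟩, (key _ inf_le_right w).mpr rfl⟩
      · rintro ⟨c, hc⟩
        exact hP (mem_stanleySet_iff.mp hc).1 c.2.1)
    (fun c d hcd => Set.disjoint_left.mpr fun w hwc hwd =>
      hcd (Subtype.ext (((key _ c.2.2 w).mp hwc).symm.trans ((key _ d.2.2 w).mp hwd))))
  exact ⟨D⟩

/-- A translate of a Stanley space meets the positive orthant in a Stanley space, as soon as
it meets it at all. -/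
theorem add_mem_stanleySet_iff {σ : Type} {u v d : σ →₀ ℕ} {Z : Set σ}
    (h : ∀ i ∉ Z, v i ≤ u i) : d + v ∈ stanleySet u Z ↔ d ∈ stanleySet (u - v) Z := by
  simp only [mem_stanleySet_iff, tsub_le_iff_right, Finsupp.add_apply, Finsupp.tsub_apply]
  refine and_congr_right fun _ => forall₂_congr fun i hi => ?_
  have := h i hi
  omega

/-- A Stanley partition of `P` induces one, of at most the same length, of the part of the
translate `P - v` in the positive orthant. -/
theorem StanleyPartition.exists_translate_le {σ : Type} {P : Set (σ →₀ ℕ)}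
    (D : StanleyPartition P) (v : σ →₀ ℕ) :
    ∃ D' : StanleyPartition {d | d + v ∈ P}, D'.r ≤ D.r := by
  let ι := {i : Fin D.r // ∀ j ∉ D.vars i, v j ≤ D.base i j}
  obtain ⟨D', hD'⟩ := StanleyPartition.exists_of_finite (P := {d | d + v ∈ P})
    (fun i : ι => D.base i - v) (fun i => D.vars i)
    (by
      ext d
      simp only [Set.mem_ofPred_eq, Set.mem_iUnion]
      refine (Set.ext_iff.mp D.cover (d + v)).trans (Set.mem_iUnion.trans ?_)
      constructor
      · rintro ⟨i, hi⟩
        have h : ∀ j ∉ D.vars i, v j ≤ D.base i j := fun j hj => by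
          rw [← (mem_stanleySet_iff.mp hi).2 j hj]
          simp
        exact ⟨⟨i, h⟩, (add_mem_stanleySet_iff h).mp hi⟩
      · rintro ⟨i, hi⟩
        exact ⟨i, (add_mem_stanleySet_iff i.2).mpr hi⟩)
    (fun i j hij => Set.disjoint_left.mpr fun d hi hj =>
      Set.disjoint_left.mp (D.disj i j (Subtype.coe_injective.ne hij))
        ((add_mem_stanleySet_iff i.2).mpr hi) ((add_mem_stanleySet_iff j.2).mpr hj))
  refine ⟨D', hD'.trans_le ?_⟩
  simpa using Nat.card_le_card_of_injective (Subtype.val : ι → Fin D.r) Subtype.val_injective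

/-- If every element of `P` lies above `v`, a Stanley partition of `P - v` shifts to one
of `P`. -/
theorem StanleyPartition.exists_of_translate {σ : Type} {P : Set (σ →₀ ℕ)} {v : σ →₀ ℕ}
    (hv : ∀ d ∈ P, v ≤ d) (D : StanleyPartition {d | d + v ∈ P}) :
    ∃ D' : StanleyPartition P, D'.r = D.r := by
  have key : ∀ (u w : σ →₀ ℕ) (Z : Set σ),
      w ∈ stanleySet (u + v) Z ↔ v ≤ w ∧ w - v ∈ stanleySet u Z := by
    intro u w Z
    have hiff (h : v ≤ w) : w ∈ stanleySet (u + v) Z ↔ w - v ∈ stanleySet u Z := by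
      have := add_mem_stanleySet_iff (u := u + v) (v := v) (d := w - v) (Z := Z) (by simp)
      rwa [tsub_add_cancel_of_le h, add_tsub_cancel_right] at this
    refine ⟨fun hw => ?_, fun ⟨h, hw⟩ => (hiff h).mpr hw⟩
    have h : v ≤ w := le_add_self.trans (mem_stanleySet_iff.mp hw).1
    exact ⟨h, (hiff h).mp hw⟩
  have hmem (w : σ →₀ ℕ) (hw : v ≤ w) :
      w ∈ P ↔ ∃ i, w - v ∈ stanleySet (D.base i) (D.vars i) := by
    rw [← Set.mem_iUnion, ← D.cover, Set.mem_ofPred_eq, tsub_add_cancel_of_le hw]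
  refine ⟨⟨D.r, fun i => D.base i + v, D.vars, ?_, fun i j hij => ?_⟩, rfl⟩
  · ext w
    simp only [Set.mem_iUnion, key]
    exact ⟨fun hw => ((hmem w (hv w hw)).mp hw).imp fun i hi => ⟨hv w hw, hi⟩,
      fun ⟨i, h, hi⟩ => (hmem w h).mpr ⟨i, hi⟩⟩
  · exact Set.disjoint_left.mpr fun w hi hj =>
      Set.disjoint_left.mp (D.disj i j hij) ((key _ _ _).mp hi).2 ((key _ _ _).mp hj).2

theorem isUpperSet_monSet {σ K : Type} [Field K] (I : Ideal (MvPolynomial σ K)) :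
    IsUpperSet (monSet I) := by
  intro d e hde hd
  have := I.mul_mem_left (monomial (e - d) (1 : K)) hd
  rwa [monomial_mul, tsub_add_cancel_of_le hde, one_mul] at this

theorem monSet_colon_span_monomial {σ K : Type} [Field K] (I : Ideal (MvPolynomial σ K))
    (v : σ →₀ ℕ) :
    monSet (Submodule.colon I (Ideal.span {(monomial v (1 : K) : MvPolynomial σ K)})) =
      {d | d + v ∈ monSet I} := by
  ext d
  simp [monSet, monomial_mul]

theorem le_of_mem_monSet_span_monomial_mul {σ K : Type} [Field K]
    {J : Ideal (MvPolynomial σ K)} {v d : σ →₀ ℕ}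
    (hd : d ∈ monSet (Ideal.span {(monomial v (1 : K) : MvPolynomial σ K)} * J)) : v ≤ d := by
  classical
  obtain ⟨z, -, hz⟩ := Ideal.mem_span_singleton_mul.mp hd
  by_contra h
  have := congrArg (coeff d) hz
  rw [coeff_monomial_mul', if_neg h, coeff_monomial, if_pos rfl] at this
  exact zero_ne_one this

/-- For a nonzero monomial ideal `I` and a monomial `v`,
`slength(I : v) ≤ slength(I)`, with equality when `I = v·(I : v)`. -/
theorem stmt_3 {K : Type} [Field K] {n : ℕ} (I : Ideal (MvPolynomial (Fin n) K))
    (hmon : IsMonomialIdeal I) (hne : I ≠ ⊥) (v : Fin n →₀ ℕ) :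
    slength (monSet (Submodule.colon I
        (Ideal.span {(monomial v (1 : K) : MvPolynomial (Fin n) K)}))) ≤
      slength (monSet I) ∧
    (I = Ideal.span {(monomial v (1 : K) : MvPolynomial (Fin n) K)} *
        Submodule.colon I (Ideal.span {(monomial v (1 : K) : MvPolynomial (Fin n) K)}) →
      slength (monSet (Submodule.colon I
          (Ideal.span {(monomial v (1 : K) : MvPolynomial (Fin n) K)}))) =
        slength (monSet I)) := by
  have hI : Nonempty (StanleyPartition (monSet I)) := (isUpperSet_monSet I).nonempty_stanleyPartition
  have hle : slength {d | d + v ∈ monSet I} ≤ slength (monSet I) := by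
    obtain ⟨D, hD⟩ := exists_stanleyPartition_r_eq_slength hI
    obtain ⟨D', hD'⟩ := D.exists_translate_le v
    exact (slength_le_of_stanleyPartition D').trans (hD'.trans hD.le)
  refine ⟨by rwa [monSet_colon_span_monomial], fun h => ?_⟩
  rw [monSet_colon_span_monomial]
  refine hle.antisymm ?_
  obtain ⟨D, hD⟩ := exists_stanleyPartition_r_eq_slength
    (hI.elim fun D => (D.exists_translate_le v).nonempty)
  obtain ⟨D', hD'⟩ := D.exists_of_translate fun d hd =>
    le_of_mem_monSet_span_monomial_mul (h ▸ hd)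
  exact (slength_le_of_stanleyPartition D').trans (hD'.trans hD).le
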